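/- For every X ⊆ Π the following are equivalent: (1) X has measure 0, i.e., the outer measure of X under μ is 0; (2) for every ε > 0 there is a permutation martingale d with d([]) < ε and X ⊆ S^1[d]; (3) there is a permutation martingale d with X ⊆ S^∞[d]. -/

import Mathlib

open Filter MeasureTheory

/-- Binary strings. -/
abbrev Str := List Bool

/-- The standard length-lexicographic enumeration `s_0 = λ, s_1 = 0, s_2 = 1, s_3 = 00, …`
of binary strings: `stdEnum n` is the binary representation of `n+1` with the leading 1 removed. -/
def stdEnum (n : ℕ) : Str := ((n + 1).bits.dropLast).reverse

/-- The set Π of length-preserving permutations of `{0,1}*`. -/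
structure LPPerm where
  toFun : Str → Str
  bij : Function.Bijective toFun
  lenPres : ∀ x, (toFun x).length = x.length

/-- `g` is a prefix partial permutation: a finite list of pairwise distinct binary strings
with `|g(s_i)| = |s_i|` for all `i < |g|`. -/
def IsPPP (g : List Str) : Prop :=
  g.Nodup ∧ ∀ i (h : i < g.length), (g.get ⟨i, h⟩).length = (stdEnum i).length

/-- The finite set of binary strings of length `n`. -/
def strsOfLen (n : ℕ) : Finset Str :=
  (Finset.univ : Finset (Fin n → Bool)).image List.ofFn

/-- `free(g)`: strings of length `|s_{|g|}|` that do not occur as entries of `g`. -/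
def freeSet (g : List Str) : Finset Str :=
  (strsOfLen (stdEnum g.length).length).filter (fun x => x ∉ g)

/-- A permutation martingale: nonnegative and satisfying the averaging condition
`d(g) = (1/|free(g)|) · Σ_{x ∈ free(g)} d((g,x))` on prefix partial permutations. -/
def IsPermMartingale (d : List Str → ℝ) : Prop :=
  (∀ g, 0 ≤ d g) ∧
    ∀ g, IsPPP g → d g = (1 / ((freeSet g).card : ℝ)) * ∑ x ∈ freeSet g, d (g ++ [x])

/-- The cylinder measure `μ(g) = (∏_{k<n} 1/(2^k)!) · (2^n − m)!/(2^n)!` where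
`2^n − 1 ≤ |g| < 2^{n+1} − 1` (so `n = log2(|g|+1)`) and `m = |g| − (2^n − 1)`. -/
noncomputable def muPPP (g : List Str) : ℝ :=
  (∏ k ∈ Finset.range (Nat.log2 (g.length + 1)), (1 : ℝ) / (Nat.factorial (2 ^ k))) *
      (Nat.factorial
        (2 ^ Nat.log2 (g.length + 1) - (g.length - (2 ^ Nat.log2 (g.length + 1) - 1)))) /
      (Nat.factorial (2 ^ Nat.log2 (g.length + 1)))

/-- The cylinder of all permutations extending the prefix partial permutation `g`. -/
def cyl (g : List Str) : Set LPPerm :=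
  {π | ∀ i (h : i < g.length), π.toFun (stdEnum i) = g.get ⟨i, h⟩}

/-- The σ-algebra `F_Π` generated by the cylinders. -/
instance : MeasurableSpace LPPerm :=
  MeasurableSpace.generateFrom {S | ∃ g, IsPPP g ∧ S = cyl g}

/-- `π↾N = [π(s_0), …, π(s_{N−1})]`. -/
def LPPerm.restrict (π : LPPerm) (N : ℕ) : List Str :=
  (List.range N).map (fun i => π.toFun (stdEnum i))

/-- `d` succeeds on `π`: `limsup_{N→∞} d(π↾N) = ∞`. -/
def succeedsOn (d : List Str → ℝ) (π : LPPerm) : Prop :=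
  ∀ C : ℝ, ∃ᶠ N in atTop, C < d (π.restrict N)

theorem bits_dropLast_append {n : ℕ} (hn : n ≠ 0) : n.bits.dropLast ++ [true] = n.bits := by
  induction n using Nat.binaryRec' with
  | zero => exact absurd rfl hn
  | bit b n h ih =>
    rw [Nat.bits_append_bit n b h]
    rcases eq_or_ne n 0 with rfl | h0
    · simp [h rfl]
    · have h1 : n.bits ≠ [] := by
        intro h1
        have := ih h0
        simp [h1] at this
      rw [List.dropLast_cons_of_ne_nil h1, List.cons_append, ih h0]

theorem stdEnum_injective : Function.Injective stdEnum := by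
  intro m n h
  have h1 : (m + 1).bits.dropLast = (n + 1).bits.dropLast := List.reverse_injective h
  have h2 : (m + 1).bits = (n + 1).bits := by
    rw [← bits_dropLast_append m.succ_ne_zero, ← bits_dropLast_append n.succ_ne_zero, h1]
  have h3 : m + 1 = n + 1 := Nat.eq_of_testBit_eq fun i => by
    rw [Nat.testBit_eq_inth, Nat.testBit_eq_inth, h2]
  omega

theorem mem_strsOfLen {n : ℕ} {x : Str} : x ∈ strsOfLen n ↔ x.length = n := by
  simp only [strsOfLen, Finset.mem_image, Finset.mem_univ, true_and]
  constructor
  · rintro ⟨f, rfl⟩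
    simp
  · rintro rfl
    exact ⟨x.get, List.ofFn_get x⟩

theorem mem_freeSet {g : List Str} {x : Str} :
    x ∈ freeSet g ↔ x.length = (stdEnum g.length).length ∧ x ∉ g := by
  simp [freeSet, mem_strsOfLen]

theorem isPPP_nil : IsPPP [] := ⟨List.nodup_nil, fun i h => absurd h (Nat.not_lt_zero i)⟩

theorem IsPPP.append {g : List Str} (hg : IsPPP g) {x : Str} (hx : x ∈ freeSet g) :
    IsPPP (g ++ [x]) := by
  rw [mem_freeSet] at hx
  refine ⟨?_, fun i h => ?_⟩
  · rw [List.nodup_append]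
    refine ⟨hg.1, List.nodup_singleton x, fun a ha b hb => ?_⟩
    rw [List.mem_singleton.1 hb]
    rintro rfl
    exact hx.2 ha
  · rw [List.length_append, List.length_singleton] at h
    rcases Nat.lt_succ_iff_lt_or_eq.1 h with h | rfl
    · simpa [List.getElem_append_left h] using hg.2 i h
    · simpa using hx.1

theorem LPPerm.length_restrict (π : LPPerm) (N : ℕ) : (π.restrict N).length = N := by
  simp [LPPerm.restrict]

theorem LPPerm.isPPP_restrict (π : LPPerm) (N : ℕ) : IsPPP (π.restrict N) := by
  refine ⟨?_, fun i h => ?_⟩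
  · exact List.nodup_range.map (π.bij.injective.comp stdEnum_injective)
  · simp [LPPerm.restrict, π.lenPres]

theorem mem_cyl_iff {g : List Str} {π : LPPerm} : π ∈ cyl g ↔ π.restrict g.length = g := by
  constructor
  · intro h
    refine List.ext_getElem (π.length_restrict _) fun i h1 h2 => ?_
    simpa [LPPerm.restrict] using h i h2
  · intro h i hi
    have : (π.restrict g.length)[i]'(by rwa [π.length_restrict]) = g[i] := by simp only [h]
    simpa [LPPerm.restrict] using this

theorem mem_cyl_restrict {π ρ : LPPerm} {N : ℕ} :
    ρ ∈ cyl (π.restrict N) ↔ ∀ i < N, ρ.toFun (stdEnum i) = π.toFun (stdEnum i) := by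
  rw [mem_cyl_iff, π.length_restrict]
  simp [LPPerm.restrict, List.map_inj_left]

theorem LPPerm.restrict_succ (π : LPPerm) (N : ℕ) :
    π.restrict (N + 1) = π.restrict N ++ [π.toFun (stdEnum N)] := by
  simp [LPPerm.restrict, List.range_succ]

theorem mem_cyl_append {g : List Str} {x : Str} {π : LPPerm} :
    π ∈ cyl (g ++ [x]) ↔ π ∈ cyl g ∧ π.toFun (stdEnum g.length) = x := by
  rw [mem_cyl_iff, mem_cyl_iff, List.length_append, List.length_singleton, π.restrict_succ]
  constructor
  · intro h
    have := List.append_inj h (π.length_restrict _)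
    exact ⟨this.1, by simpa using this.2⟩
  · rintro ⟨h, rfl⟩
    rw [h]

theorem apply_mem_freeSet {g : List Str} {π : LPPerm} (h : π ∈ cyl g) :
    π.toFun (stdEnum g.length) ∈ freeSet g := by
  refine mem_freeSet.2 ⟨π.lenPres _, fun hx => ?_⟩
  obtain ⟨i, hi, hix⟩ := List.mem_iff_getElem.1 hx
  have h1 : π.toFun (stdEnum i) = π.toFun (stdEnum g.length) := by
    rw [← hix]
    exact h i hi
  exact hi.ne (stdEnum_injective (π.bij.injective h1))

theorem cyl_eq_biUnion (g : List Str) : cyl g = ⋃ x ∈ freeSet g, cyl (g ++ [x]) := by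
  ext π
  simp only [Set.mem_iUnion, mem_cyl_append, exists_prop]
  exact ⟨fun h => ⟨_, apply_mem_freeSet h, h, rfl⟩, fun ⟨_, _, h, _⟩ => h⟩

theorem measurableSet_cyl {g : List Str} (hg : IsPPP g) : MeasurableSet (cyl g) :=
  MeasurableSpace.measurableSet_generateFrom ⟨g, hg, rfl⟩

theorem measureReal_cyl_eq_sum (ν : Measure LPPerm) [IsFiniteMeasure ν] {g : List Str}
    (hg : IsPPP g) : ν.real (cyl g) = ∑ x ∈ freeSet g, ν.real (cyl (g ++ [x])) := by
  rw [cyl_eq_biUnion g]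
  refine measureReal_biUnion_finset (fun x _ y _ hxy => ?_)
    fun x hx => measurableSet_cyl (hg.append hx)
  rw [Function.onFun, Set.disjoint_left]
  intro π h1 h2
  exact hxy ((mem_cyl_append.1 h1).2.symm.trans (mem_cyl_append.1 h2).2)

theorem muPPP_pos (g : List Str) : 0 < muPPP g := by
  unfold muPPP
  have h : 0 < ∏ k ∈ Finset.range (Nat.log2 (g.length + 1)), (1 : ℝ) / (Nat.factorial (2 ^ k)) :=
    Finset.prod_pos fun k _ => by positivity
  positivity

theorem muPPP_congr {g h : List Str} (hgh : g.length = h.length) : muPPP g = muPPP h := by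
  unfold muPPP
  rw [hgh]

section Measure

variable {μ : Measure LPPerm}

theorem measureReal_cyl
    (hμ : ∀ g, IsPPP g → μ (cyl g) = ENNReal.ofReal (muPPP g))
    {g : List Str} (hg : IsPPP g) : μ.real (cyl g) = muPPP g := by
  rw [measureReal_def, hμ g hg, ENNReal.toReal_ofReal (muPPP_pos g).le]

/-- All one-step extensions of `g` have the same measure. -/
theorem card_freeSet_mul_muPPP [IsProbabilityMeasure μ]
    (hμ : ∀ g, IsPPP g → μ (cyl g) = ENNReal.ofReal (muPPP g))
    {g : List Str} (hg : IsPPP g) (y : Str) :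
    (freeSet g).card * muPPP (g ++ [y]) = muPPP g := by
  rw [← measureReal_cyl hμ hg, measureReal_cyl_eq_sum μ hg, Finset.sum_congr rfl fun x hx =>
    (measureReal_cyl hμ (hg.append hx)).trans
      (muPPP_congr (g := g ++ [x]) (h := g ++ [y]) (by simp)), Finset.sum_const, nsmul_eq_mul]

/-- The density of a finite measure with respect to `μ` along cylinders is a martingale. -/
theorem isPermMartingale_density [IsProbabilityMeasure μ]
    (hμ : ∀ g, IsPPP g → μ (cyl g) = ENNReal.ofReal (muPPP g))
    (ν : Measure LPPerm)
    [IsFiniteMeasure ν] : IsPermMartingale fun g => ν.real (cyl g) / muPPP g := by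
  refine ⟨fun g => div_nonneg measureReal_nonneg (muPPP_pos g).le, fun g hg => ?_⟩
  have h1 := card_freeSet_mul_muPPP hμ hg []
  have h2 : ∑ x ∈ freeSet g, ν.real (cyl (g ++ [x])) / muPPP (g ++ [x])
      = ν.real (cyl g) / muPPP (g ++ [[]]) := by
    rw [measureReal_cyl_eq_sum ν hg, Finset.sum_div]
    refine Finset.sum_congr rfl fun x _ => ?_
    rw [muPPP_congr (g := g ++ [x]) (h := g ++ [[]]) (by simp)]
  simp only [h2, ← h1]
  ring

theorem muPPP_nil [IsProbabilityMeasure μ]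
    (hμ : ∀ g, IsPPP g → μ (cyl g) = ENNReal.ofReal (muPPP g))
    : muPPP [] = 1 := by
  rw [← measureReal_cyl hμ isPPP_nil]
  have : cyl [] = Set.univ := Set.eq_univ_of_forall fun π i h => absurd h (Nat.not_lt_zero i)
  simp [this]

theorem ville_finite [IsProbabilityMeasure μ]
    (hμ : ∀ g, IsPPP g → μ (cyl g) = ENNReal.ofReal (muPPP g))
    {d : List Str → ℝ} (hd : IsPermMartingale d)
    {c : ℝ} (hc : 0 < c) (n : ℕ) {g : List Str} (hg : IsPPP g) :
    c * μ.real {π | π ∈ cyl g ∧ ∃ k < n, c ≤ d (π.restrict (g.length + k))} ≤ d g * muPPP g := by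
  induction n generalizing g with
  | zero => simpa using mul_nonneg (hd.1 g) (muPPP_pos g).le
  | succ n ih =>
    rcases le_or_gt c (d g) with h | h
    · rw [← measureReal_cyl hμ hg]
      exact mul_le_mul h (measureReal_mono fun π hπ => hπ.1) measureReal_nonneg (hd.1 g)
    · have hsub : {π | π ∈ cyl g ∧ ∃ k < n + 1, c ≤ d (π.restrict (g.length + k))} ⊆
          ⋃ x ∈ freeSet g, {π | π ∈ cyl (g ++ [x]) ∧
            ∃ k < n, c ≤ d (π.restrict ((g ++ [x]).length + k))} := by
        rintro π ⟨hπ, k, hk, hle⟩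
        simp only [Set.mem_iUnion, exists_prop]
        refine ⟨_, apply_mem_freeSet hπ, mem_cyl_append.2 ⟨hπ, rfl⟩, ?_⟩
        rcases k with _ | k
        · rw [Nat.add_zero, mem_cyl_iff.1 hπ] at hle
          exact absurd hle h.not_ge
        · refine ⟨k, by omega, ?_⟩
          rwa [List.length_append, List.length_singleton, add_assoc, add_comm 1 k]
      have hcard := card_freeSet_mul_muPPP hμ hg []
      have hne : ((freeSet g).card : ℝ) ≠ 0 := by
        intro h0
        rw [h0, zero_mul] at hcard
        exact (muPPP_pos g).ne hcard
      calc _ ≤ c * ∑ x ∈ freeSet g, μ.real {π | π ∈ cyl (g ++ [x]) ∧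
            ∃ k < n, c ≤ d (π.restrict ((g ++ [x]).length + k))} :=
            mul_le_mul_of_nonneg_left ((measureReal_mono hsub (measure_ne_top μ _)).trans
              (measureReal_biUnion_finset_le _ _)) hc.le
        _ ≤ ∑ x ∈ freeSet g, d (g ++ [x]) * muPPP (g ++ [[]]) := by
            rw [Finset.mul_sum]
            refine Finset.sum_le_sum fun x hx => (ih (hg.append hx)).trans_eq ?_
            rw [muPPP_congr (g := g ++ [x]) (h := g ++ [[]]) (by simp)]
        _ = d g * muPPP g := by
            rw [← Finset.sum_mul, hd.2 g hg, ← hcard]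
            field_simp

/-- Ville's inequality for permutation martingales. -/
theorem ville_inequality [IsProbabilityMeasure μ]
    (hμ : ∀ g, IsPPP g → μ (cyl g) = ENNReal.ofReal (muPPP g))
    {d : List Str → ℝ} (hd : IsPermMartingale d)
    {c : ℝ} (hc : 0 < c) : μ.real {π | ∃ N, c ≤ d (π.restrict N)} ≤ d [] / c := by
  have hU : {π : LPPerm | ∃ N, c ≤ d (π.restrict N)} =
      ⋃ n, {π | π ∈ cyl [] ∧ ∃ k < n, c ≤ d (π.restrict (([] : List Str).length + k))} := by
    ext π
    simp only [Set.mem_iUnion, Set.mem_ofPred_eq, List.length_nil, zero_add]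
    constructor
    · rintro ⟨N, hN⟩
      exact ⟨N + 1, fun i h => absurd h (Nat.not_lt_zero i), N, N.lt_succ_self, hN⟩
    · rintro ⟨_, _, k, _, hk⟩
      exact ⟨k, hk⟩
  refine ENNReal.toReal_le_of_le_ofReal (div_nonneg (hd.1 _) hc.le) ?_
  rw [hU, Monotone.measure_iUnion]
  · refine iSup_le fun n => ?_
    rw [← ofReal_measureReal]
    refine ENNReal.ofReal_le_ofReal ((le_div_iff₀' hc).2 ?_)
    simpa [muPPP_nil hμ] using ville_finite hμ hd hc n isPPP_nil
  · rintro m n hmn π ⟨h, k, hk, hle⟩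
    exact ⟨h, k, hk.trans_le hmn, hle⟩

end Measure

/-- The coordinates of a permutation, coded as natural numbers. -/
def LPPerm.coords (π : LPPerm) (n : ℕ) : ℕ := Encodable.encode (π.toFun (stdEnum n))

/-- The topology of pointwise convergence. -/
instance : TopologicalSpace LPPerm := TopologicalSpace.induced LPPerm.coords inferInstance

theorem isInducing_coords : Topology.IsInducing LPPerm.coords := ⟨rfl⟩

instance : TopologicalSpace.PseudoMetrizableSpace LPPerm :=
  isInducing_coords.pseudoMetrizableSpace

theorem isOpen_cyl (g : List Str) : IsOpen (cyl g) := by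
  have : cyl g = ⋂ i : Fin g.length,
      LPPerm.coords ⁻¹' ((fun f => f i) ⁻¹' {Encodable.encode (g.get i)}) := by
    ext π
    simp [cyl, LPPerm.coords, Fin.forall_iff]
  rw [this]
  exact isOpen_iInter_of_finite fun i =>
    ((isOpen_discrete _).preimage (continuous_apply _)).preimage isInducing_coords.continuous

theorem IsOpen.exists_cyl_subset {U : Set LPPerm} (hU : IsOpen U) {π : LPPerm} (hπ : π ∈ U) :
    ∃ N, cyl (π.restrict N) ⊆ U := by
  obtain ⟨V, hV, rfl⟩ := isInducing_coords.isOpen_iff.1 hU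
  obtain ⟨_, ⟨y, N, rfl⟩, hy, hsub⟩ :=
    (PiNat.isTopologicalBasis_cylinders fun _ : ℕ => ℕ).exists_subset_of_mem_open
      (a := π.coords) hπ hV
  refine ⟨N, fun ρ hρ => hsub ?_⟩
  rw [← PiNat.mem_cylinder_iff_eq.1 hy, PiNat.mem_cylinder_iff]
  intro i hi
  rw [LPPerm.coords, LPPerm.coords, mem_cyl_restrict.1 hρ i hi]

instance : BorelSpace LPPerm := by
  refine ⟨le_antisymm ?_ ?_⟩
  · refine MeasurableSpace.generateFrom_le ?_
    rintro _ ⟨g, _, rfl⟩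
    exact MeasurableSpace.measurableSet_generateFrom (isOpen_cyl g)
  · refine MeasurableSpace.generateFrom_le fun U (hU : IsOpen U) => ?_
    have : U = ⋃ g ∈ {g | IsPPP g ∧ cyl g ⊆ U}, cyl g := by
      refine Set.Subset.antisymm (fun π hπ => ?_) (Set.iUnion₂_subset fun g hg => hg.2)
      obtain ⟨N, hN⟩ := hU.exists_cyl_subset hπ
      exact Set.mem_biUnion (x := π.restrict N) ⟨π.isPPP_restrict N, hN⟩
        (mem_cyl_restrict.2 fun _ _ => rfl)
    rw [this]
    exact MeasurableSet.biUnion (Set.to_countable _) fun g hg => measurableSet_cyl hg.1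

theorem IsOpen.eventually_cyl_subset {U : Set LPPerm} (hU : IsOpen U) {π : LPPerm} (hπ : π ∈ U) :
    ∀ᶠ N in atTop, cyl (π.restrict N) ⊆ U := by
  obtain ⟨N, hN⟩ := hU.exists_cyl_subset hπ
  filter_upwards [eventually_ge_atTop N] with M hM
  exact fun ρ hρ => hN (mem_cyl_restrict.2 fun i hi =>
    mem_cyl_restrict.1 hρ i (hi.trans_le hM))

section Null

variable {μ : Measure LPPerm} [IsProbabilityMeasure μ] {X : Set LPPerm}

theorem exists_martingale_lt_of_null
    (hμ : ∀ g, IsPPP g → μ (cyl g) = ENNReal.ofReal (muPPP g))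
    (hX : μ X = 0) {ε : ℝ} (hε : 0 < ε) :
    ∃ d : List Str → ℝ, IsPermMartingale d ∧ d [] < ε ∧
      X ⊆ {π : LPPerm | ∃ N, 1 ≤ d (π.restrict N)} := by
  obtain ⟨U, hXU, hU, hlt⟩ := X.exists_isOpen_lt_of_lt (μ := μ) (ENNReal.ofReal ε) (by simpa [hX])
  refine ⟨_, isPermMartingale_density hμ (μ.restrict U), ?_, fun π hπ => ?_⟩
  · rw [muPPP_nil hμ, div_one]
    refine lt_of_le_of_lt ?_ ((ENNReal.lt_ofReal_iff_toReal_lt (measure_ne_top μ U)).1 hlt)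
    exact ENNReal.toReal_mono (measure_ne_top μ U)
      ((measure_mono (Set.subset_univ _)).trans_eq (Measure.restrict_apply_univ U))
  · obtain ⟨N, hN⟩ := hU.exists_cyl_subset (hXU hπ)
    refine ⟨N, ?_⟩
    have hp := π.isPPP_restrict N
    rw [measureReal_restrict_apply (measurableSet_cyl hp), Set.inter_eq_left.2 hN,
      measureReal_cyl hμ hp, div_self (muPPP_pos _).ne']

theorem exists_succeeding_martingale_of_null
    (hμ : ∀ g, IsPPP g → μ (cyl g) = ENNReal.ofReal (muPPP g))
    (hX : μ X = 0) :
    ∃ d : List Str → ℝ, IsPermMartingale d ∧ X ⊆ {π : LPPerm | succeedsOn d π} := by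
  obtain ⟨δ, hδ, hsum⟩ := ENNReal.exists_pos_sum_of_countable' one_ne_zero ℕ
  choose U hXU hU hlt using fun k => X.exists_isOpen_lt_of_lt (μ := μ) (δ k) (hX ▸ hδ k)
  let ν := Measure.sum fun k => μ.restrict (U k)
  have hν : IsFiniteMeasure ν := by
    refine ⟨?_⟩
    rw [Measure.sum_apply _ MeasurableSet.univ]
    refine (ENNReal.tsum_le_tsum fun k => ?_).trans_lt (hsum.trans ENNReal.one_lt_top)
    rw [Measure.restrict_apply_univ]
    exact (hlt k).le
  refine ⟨_, isPermMartingale_density hμ ν, fun π hπ C => Eventually.frequently ?_⟩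
  obtain ⟨K, hK⟩ := exists_nat_gt C
  have hev : ∀ᶠ N in atTop, ∀ k ∈ Finset.range K, cyl (π.restrict N) ⊆ U k :=
    (eventually_all_finset _).2 fun k _ => (hU k).eventually_cyl_subset (hXU k hπ)
  filter_upwards [hev] with N hN
  refine hK.trans_le ((le_div_iff₀ (muPPP_pos _)).2 ?_)
  have hp := π.isPPP_restrict N
  refine (ENNReal.ofReal_le_iff_le_toReal (measure_ne_top ν _)).1 ?_
  rw [Measure.sum_apply _ (measurableSet_cyl hp)]
  refine le_trans ?_ (ENNReal.sum_le_tsum (Finset.range K))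
  rw [Finset.sum_congr rfl fun k hk => by
    rw [Measure.restrict_apply (measurableSet_cyl hp), Set.inter_eq_left.2 (hN k hk), hμ _ hp]]
  rw [Finset.sum_const, Finset.card_range, nsmul_eq_mul, ENNReal.ofReal_mul K.cast_nonneg,
    ENNReal.ofReal_natCast]

theorem null_of_exists_martingale_lt
    (hμ : ∀ g, IsPPP g → μ (cyl g) = ENNReal.ofReal (muPPP g))
    (h : ∀ ε : ℝ, 0 < ε → ∃ d : List Str → ℝ, IsPermMartingale d ∧ d [] < ε ∧
      X ⊆ {π : LPPerm | ∃ N, 1 ≤ d (π.restrict N)}) : μ X = 0 := by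
  rw [← measureReal_eq_zero_iff]
  refine le_antisymm (le_of_forall_pos_lt_add fun ε hε => ?_) measureReal_nonneg
  obtain ⟨d, hd, hlt, hsub⟩ := h ε hε
  have := (measureReal_mono hsub).trans (ville_inequality hμ hd one_pos)
  linarith

theorem null_of_succeeding_martingale
    (hμ : ∀ g, IsPPP g → μ (cyl g) = ENNReal.ofReal (muPPP g))
    {d : List Str → ℝ} (hd : IsPermMartingale d)
    (h : X ⊆ {π : LPPerm | succeedsOn d π}) : μ X = 0 := by
  refine null_of_exists_martingale_lt hμ fun ε hε => ?_
  have hpos : 0 < (d [] + 1) / ε := div_pos (by linarith [hd.1 []]) hε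
  refine ⟨fun g => d g / ((d [] + 1) / ε), ⟨fun g => div_nonneg (hd.1 g) hpos.le, fun g hg => ?_⟩,
    ?_, fun π hπ => ?_⟩
  · rw [← Finset.sum_div, ← mul_div_assoc, ← hd.2 g hg]
  · have h0 := hd.1 []
    rw [div_lt_iff₀ hpos, mul_div_cancel₀ _ hε.ne']
    linarith
  · obtain ⟨N, hN⟩ := (h hπ ((d [] + 1) / ε)).exists
    exact ⟨N, (one_le_div hpos).2 hN.le⟩

end Null

/-- analogue of Ville's theorem: for every `X ⊆ Π`, `X` has outer measure 0 under
`μ` iff for every `ε > 0` there is a permutation martingale `d` with `d([]) < ε` and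
`X ⊆ S^1[d]`, iff there is a permutation martingale `d` with `X ⊆ S^∞[d]`. -/
theorem stmt3 (μ : Measure LPPerm) (hprob : IsProbabilityMeasure μ)
    (hμ : ∀ g, IsPPP g → μ (cyl g) = ENNReal.ofReal (muPPP g))
    (X : Set LPPerm) :
    (μ X = 0 ↔
      ∀ ε : ℝ, 0 < ε → ∃ d : List Str → ℝ, IsPermMartingale d ∧ d [] < ε ∧
        X ⊆ {π : LPPerm | ∃ N, 1 ≤ d (π.restrict N)}) ∧
    (μ X = 0 ↔
      ∃ d : List Str → ℝ, IsPermMartingale d ∧ X ⊆ {π : LPPerm | succeedsOn d π}) := by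
  exact ⟨⟨fun h _ hε => exists_martingale_lt_of_null hμ h hε, null_of_exists_martingale_lt hμ⟩,
    exists_succeeding_martingale_of_null hμ,
    fun ⟨_, hd, h⟩ => null_of_succeeding_martingale hμ hd h⟩
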